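/- Let q be a complex number with 0 < |q| < 1, let a be a nonzero complex number with a ∉ {q^m : m ∈ ℤ}, let λ be a nonzero complex number with λ ∉ {−q^m : m ∈ ℤ} and aλ, ax ∉ {−q^m : m ∈ ℤ}, and let x be a nonzero complex number with |ax| > 1, x ∉ {−λ q^m : m ∈ ℤ}, and x ∉ {−q^m : m ∈ ℤ}. Define ψ̃^B_λ(x) := Σ_{n∈ℤ} [ ψ_B(λq^n) / θ_q(λq^n/x) ] with ψ_B(ξ) := ((q;q)_∞/(q/a;q)_∞)(θ_q(aξ)/θ_q(ξ))(−q/ξ;q)_∞, and define v̂(x) := (θ_q(ax)/θ_q(x)) ₁φ₀(0;−;q,1/(ax)) with ₁φ₀(0;−;q,z) := Σ_{m≥0} z^m/(q;q)_m. Then ψ̃^B_λ(x) = C_B(x) v̂(x), where C_B(x) := ((q;q)_∞/(q/a;q)_∞) · (θ_q(aλ)/θ_q(λ)) · (θ_q(aqx/λ)/θ_q(qx/λ)) · (θ_q(x)/θ_q(ax)). -/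

import Mathlib

open Complex Filter Topology

noncomputable def qPochInt (q a : ℂ) (n : ℤ) : ℂ :=
  if 0 ≤ n then ∏ k ∈ Finset.range n.toNat, (1 - a * q ^ k)
  else (∏ k ∈ Finset.range (-n).toNat, (1 - a * q ^ (-(k + 1 : ℤ))))⁻¹

noncomputable def qPochInf (q a : ℂ) : ℂ := ∏' k : ℕ, (1 - a * q ^ k)

noncomputable def thetaQ (q z : ℂ) : ℂ := ∑' n : ℤ, q ^ (n * (n - 1) / 2) * z ^ n


namespace Stmt8Aux

def tri (n : ℤ) : ℤ := n * (n - 1) / 2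

lemma two_tri (n : ℤ) : 2 * tri n = n * (n - 1) :=
  Int.mul_ediv_cancel' (Int.even_mul_pred_self n).two_dvd

lemma tri_add (m k : ℤ) : tri (m + k) = tri m + tri k + m * k := by
  have h : 2 * tri (m + k) = 2 * (tri m + tri k + m * k) := by
    linear_combination two_tri (m + k) - two_tri m - two_tri k
  omega

lemma tri_sub (m k : ℤ) : tri (m - k) = tri m + tri k + k - m * k := by
  have h : 2 * tri (m - k) = 2 * (tri m + tri k + k - m * k) := by
    linear_combination two_tri (m - k) - two_tri m - two_tri k
  omega

lemma tri_zero : tri 0 = 0 := by decide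

lemma tri_one : tri 1 = 0 := by decide

lemma thetaQ_eq (q z : ℂ) : thetaQ q z = ∑' n : ℤ, q ^ tri n * z ^ n := rfl

noncomputable def P (q : ℂ) (m : ℕ) : ℂ := ∏ k ∈ Finset.range m, (1 - q * q ^ k)

lemma qPochInt_eq (q : ℂ) (m : ℕ) : qPochInt q q m = P q m := by
  simp [qPochInt, P]

lemma one_sub_ne {q : ℂ} (hq1 : ‖q‖ < 1) (k : ℕ) : 1 - q * q ^ k ≠ 0 := by
  intro h
  have h1 : q ^ (k + 1) = 1 := by rw [pow_succ']; linear_combination -h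
  have h2 : ‖q‖ ^ (k + 1) = 1 := by rw [← norm_pow, h1, norm_one]
  exact absurd h2 (pow_lt_one₀ (norm_nonneg _) hq1 (by omega)).ne

lemma P_ne {q : ℂ} (hq1 : ‖q‖ < 1) (m : ℕ) : P q m ≠ 0 :=
  Finset.prod_ne_zero_iff.2 fun k _ => one_sub_ne hq1 k

lemma P_succ (q : ℂ) (m : ℕ) : P q (m + 1) = P q m * (1 - q * q ^ m) :=
  Finset.prod_range_succ _ _

lemma ratio {f r : ℕ → ℂ} {l : ℂ} (hl : ‖l‖ < 1) (hf : ∀ n, f n ≠ 0)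
    (hr : ∀ n, f (n + 1) = r n * f n) (ht : Tendsto r atTop (𝓝 l)) :
    Summable f := by
  refine summable_of_ratio_test_tendsto_lt_one hl (Eventually.of_forall hf) ?_
  refine ht.norm.congr fun n => ?_
  rw [hr, norm_mul, mul_div_cancel_right₀ _ (norm_ne_zero_iff.2 (hf n))]

lemma pow_tendsto {q : ℂ} (hq1 : ‖q‖ < 1) : Tendsto (fun n : ℕ => q ^ n) atTop (𝓝 0) :=
  tendsto_pow_atTop_nhds_zero_of_norm_lt_one hq1

lemma summable_theta {q w : ℂ} (hq : q ≠ 0) (hq1 : ‖q‖ < 1) (hw : w ≠ 0) :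
    Summable fun n : ℤ => q ^ tri n * w ^ n := by
  have hne : ∀ n : ℤ, q ^ tri n * w ^ n ≠ 0 := fun n =>
    mul_ne_zero (zpow_ne_zero _ hq) (zpow_ne_zero _ hw)
  apply Summable.of_nat_of_neg
  · refine ratio (l := 0) (r := fun n => q ^ n * w) (by simp) (fun n => hne n) (fun n => ?_) ?_
    · push_cast
      rw [tri_add, tri_one, zpow_add₀ hw, mul_one, add_zero, zpow_add₀ hq]
      simp only [zpow_natCast, zpow_one]
      ring
    · simpa using (pow_tendsto hq1).mul_const w
  · refine ratio (l := 0) (r := fun n => q ^ n * q * w⁻¹) (by simp) (fun n => hne (-n))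
      (fun n => ?_) ?_
    · have : (-((n + 1 : ℕ) : ℤ)) = -(n : ℤ) - 1 := by push_cast; ring
      rw [this, tri_sub, tri_one, zpow_sub₀ hw]
      have : tri (-(n:ℤ)) + 0 + 1 - -(n:ℤ) * 1 = tri (-(n:ℤ)) + (n + 1 : ℕ) := by push_cast; ring
      rw [this, zpow_add₀ hq, zpow_natCast]
      field_simp
      rw [pow_succ]
    · simpa using ((pow_tendsto hq1).mul_const q).mul_const w⁻¹

lemma den_tendsto {q : ℂ} (hq1 : ‖q‖ < 1) :
    Tendsto (fun n : ℕ => (1 - q * q ^ n)⁻¹) atTop (𝓝 1) := by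
  have := ((pow_tendsto hq1).const_mul q).const_sub 1
  simpa using this.inv₀ (by simp)

lemma summable_S {q z : ℂ} (hq1 : ‖q‖ < 1) (hz : z ≠ 0) (hz1 : ‖z‖ < 1) :
    Summable fun k : ℕ => z ^ k / P q k := by
  refine ratio (l := z) (r := fun n => z * (1 - q * q ^ n)⁻¹) hz1
    (fun n => div_ne_zero (pow_ne_zero _ hz) (P_ne hq1 n)) (fun n => ?_) ?_
  · rw [P_succ, pow_succ]
    have := P_ne hq1 n
    have := one_sub_ne hq1 n
    field_simp
  · simpa using (den_tendsto hq1).const_mul z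

lemma summable_G {q z : ℂ} (hq : q ≠ 0) (hq1 : ‖q‖ < 1) (hz : z ≠ 0) :
    Summable fun k : ℕ => q ^ tri k * z ^ k / P q k := by
  refine ratio (l := 0) (r := fun n => q ^ n * z * (1 - q * q ^ n)⁻¹) (by simp)
    (fun n => div_ne_zero (mul_ne_zero (zpow_ne_zero _ hq) (pow_ne_zero _ hz)) (P_ne hq1 n))
    (fun n => ?_) ?_
  · have h1 := P_ne hq1 n
    have h2 := one_sub_ne hq1 n
    push_cast
    rw [P_succ, pow_succ, tri_add, tri_one, mul_one, add_zero, zpow_add₀ hq, zpow_natCast]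
    field_simp
  · simpa using ((pow_tendsto hq1).mul_const z).mul (den_tendsto hq1)

noncomputable def G (q z : ℂ) : ℂ := ∑' k : ℕ, q ^ tri k * z ^ k / P q k

lemma G_step {q z : ℂ} (hq : q ≠ 0) (hq1 : ‖q‖ < 1) (hz : z ≠ 0) :
    G q z = (1 + z) * G q (z * q) := by
  have s1 := summable_G hq hq1 hz
  have s2 := summable_G hq hq1 (mul_ne_zero hz hq)
  have h : G q z - G q (z * q) = z * G q (z * q) := by
    unfold G
    rw [← s1.tsum_sub s2, (s1.sub s2).tsum_eq_zero_add, ← tsum_mul_left]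
    simp only [pow_zero, sub_self, zero_add]
    refine tsum_congr fun n => ?_
    have h1 := P_ne hq1 n
    have h2 := one_sub_ne hq1 n
    push_cast
    rw [P_succ, tri_add, tri_one, mul_one, add_zero, zpow_add₀ hq, zpow_natCast]
    have h3 : 1 - q ^ n * q ≠ 0 := by rwa [mul_comm]
    field_simp
    ring
  linear_combination h

lemma G_iter {q z : ℂ} (hq : q ≠ 0) (hq1 : ‖q‖ < 1) (hz : z ≠ 0) (N : ℕ) :
    G q z = (∏ k ∈ Finset.range N, (1 - (-z) * q ^ k)) * G q (z * q ^ N) := by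
  induction N with
  | zero => simp
  | succ N ih =>
    rw [ih, G_step hq hq1 (mul_ne_zero hz (pow_ne_zero N hq)), Finset.prod_range_succ, pow_succ]
    ring_nf

lemma G_tendsto {q z : ℂ} (hq : q ≠ 0) (hq1 : ‖q‖ < 1) (hz : z ≠ 0) :
    Tendsto (fun N : ℕ => G q (z * q ^ N)) atTop (𝓝 1) := by
  have key : ∑' k : ℕ, (if k = 0 then (1:ℂ) else 0) = 1 := by simp
  rw [← key]
  unfold G
  refine tendsto_tsum_of_dominated_convergence (summable_G hq hq1 hz).norm (fun k => ?_)
    (Eventually.of_forall fun N k => ?_)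
  · rcases Nat.eq_zero_or_pos k with rfl | hk
    · simp [tri_zero, P]
    · rw [if_neg hk.ne']
      have h := ((((pow_tendsto hq1).const_mul z).pow k).const_mul (q ^ tri k)).div_const (P q k)
      simpa [hk.ne'] using h
  · rw [norm_div, norm_div, norm_mul, norm_mul, norm_pow, norm_pow, norm_mul, norm_pow]
    gcongr
    exact mul_le_of_le_one_right (norm_nonneg _) (pow_le_one₀ (norm_nonneg _) hq1.le)

lemma summable_geo {q : ℂ} (hq1 : ‖q‖ < 1) (a : ℂ) :
    Summable fun k : ℕ => ‖-(a * q ^ k)‖ := by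
  simp only [norm_neg, norm_mul, norm_pow]
  exact (summable_geometric_of_lt_one (norm_nonneg _) hq1).mul_left _

lemma mult {q : ℂ} (hq1 : ‖q‖ < 1) (a : ℂ) : Multipliable fun k : ℕ => 1 - a * q ^ k := by
  simpa [sub_eq_add_neg] using multipliable_one_add_of_summable (summable_geo hq1 a)

lemma qPochInf_ne {q : ℂ} (hq1 : ‖q‖ < 1) (a : ℂ) (h : ∀ k : ℕ, 1 - a * q ^ k ≠ 0) :
    qPochInf q a ≠ 0 := by
  have := tprod_one_add_ne_zero_of_summable (f := fun k : ℕ => -(a * q ^ k))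
    (fun k => by simpa [sub_eq_add_neg] using h k) (summable_geo hq1 a)
  simpa [qPochInf, sub_eq_add_neg] using this

lemma euler {q z : ℂ} (hq : q ≠ 0) (hq1 : ‖q‖ < 1) (hz : z ≠ 0) :
    qPochInf q (-z) = G q z := by
  have h := ((mult hq1 (-z)).tendsto_prod_tprod_nat).mul (G_tendsto hq hq1 hz)
  rw [mul_one] at h
  have h2 : Tendsto (fun _ : ℕ => G q z) atTop (𝓝 (qPochInf q (-z))) :=
    h.congr fun N => (G_iter hq hq1 hz N).symm
  exact tendsto_nhds_unique h2 tendsto_const_nhds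

lemma main {q w c : ℂ} (hq : q ≠ 0) (hq1 : ‖q‖ < 1) (hw : w ≠ 0) (hc : c ≠ 0)
    (hwc : ‖w * c‖ < 1) :
    ∑' n : ℤ, q ^ tri n * w ^ n * qPochInf q (-(c * q ^ (1 - n)))
      = thetaQ q w * ∑' k : ℕ, (w * c) ^ k / P q k := by
  have sθ := (summable_theta hq hq1 hw).norm
  have sS := (summable_S hq1 (mul_ne_zero hw hc) hwc).norm
  rw [thetaQ_eq, tsum_mul_tsum_of_summable_norm sθ sS]
  have sP := summable_mul_of_summable_norm sθ sS
  let e : ℤ × ℕ ≃ ℤ × ℕ :=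
    { toFun := fun p => (p.1 - p.2, p.2)
      invFun := fun p => (p.1 + p.2, p.2)
      left_inv := fun p => by simp
      right_inv := fun p => by simp }
  have sE := (e.summable_iff).2 sP
  simp only [Function.comp_def] at sE
  rw [← e.tsum_eq, Summable.tsum_prod sE]
  refine tsum_congr fun n => ?_
  rw [euler hq hq1 (mul_ne_zero hc (zpow_ne_zero _ hq)), G, ← tsum_mul_left]
  refine tsum_congr fun k => ?_
  have h1 := P_ne hq1 k
  have h3 : tri (n - k) = tri n + tri k + (1 - n) * k := by rw [tri_sub]; ring
  simp only [e, Equiv.coe_fn_mk]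
  rw [h3, zpow_add₀ hq, zpow_add₀ hq, zpow_mul, zpow_natCast, zpow_sub₀ hw, zpow_natCast]
  field_simp
  try ring

lemma theta_shift {q z : ℂ} (hq : q ≠ 0) (hz : z ≠ 0) (n : ℤ) :
    thetaQ q (z * q ^ n) = (q ^ tri n * z ^ n)⁻¹ * thetaQ q z := by
  rw [thetaQ_eq, thetaQ_eq, ← tsum_mul_left,
    ← (Equiv.addRight n).tsum_eq (fun m : ℤ => (q ^ tri n * z ^ n)⁻¹ * (q ^ tri m * z ^ m))]
  refine tsum_congr fun m => ?_
  simp only [Equiv.coe_addRight]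
  rw [tri_add, zpow_add₀ hz, zpow_add₀ hq, zpow_add₀ hq, mul_zpow, ← zpow_mul, mul_comm n m]
  have := zpow_ne_zero (tri n) hq
  have := zpow_ne_zero n hz
  field_simp

lemma theta_inv {q z : ℂ} (hq : q ≠ 0) (hz : z ≠ 0) : thetaQ q (q / z) = thetaQ q z := by
  rw [thetaQ_eq, thetaQ_eq, ← (Equiv.neg ℤ).tsum_eq]
  refine tsum_congr fun m => ?_
  have h : tri (-m) = tri m + m := by
    have := tri_sub 0 m
    simpa [tri_zero] using this
  simp only [Equiv.neg_apply]
  rw [h, zpow_add₀ hq, zpow_neg, div_zpow]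
  have := zpow_ne_zero m hq
  have := zpow_ne_zero m hz
  field_simp

lemma qPochInf_split {q : ℂ} (hq1 : ‖q‖ < 1) (j : ℕ) :
    qPochInf q q = P q j * qPochInf q (q * q ^ j) := by
  have he : (fun n : ℕ => 1 - q * q ^ (n + j)) = fun n : ℕ => 1 - q * q ^ j * q ^ n := by
    funext n
    rw [pow_add]
    ring
  have hs : Multipliable fun n : ℕ => 1 - q * q ^ (n + j) := by
    rw [he]
    exact mult hq1 _
  have h := Multipliable.prod_mul_tprod_nat_mul' (f := fun n : ℕ => 1 - q * q ^ n) hs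
  simp only [he] at h
  exact h.symm

lemma theta_ne_small {q w : ℂ} (hq : q ≠ 0) (hq1 : ‖q‖ < 1) (hw : w ≠ 0) (hw1 : ‖w‖ < 1)
    (h : ∀ m : ℤ, w ≠ -(q ^ m)) : thetaQ q w ≠ 0 := by
  have hm := main hq hq1 hw (c := -1) (by simp) (by simpa using hw1)
  have hL : ∑' n : ℤ, q ^ tri n * w ^ n * qPochInf q (-(-1 * q ^ (1 - n)))
      = qPochInf q q * qPochInf q (-(q / w)) := by
    rw [euler hq hq1 (div_ne_zero hq hw), G, ← tsum_mul_left]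
    have hinj : Function.Injective (fun j : ℕ => -(j : ℤ)) := fun a b hab => by
      simpa using hab
    rw [← hinj.tsum_eq]
    · refine tsum_congr fun j => ?_
      have h0 : tri (-(j : ℤ)) = tri j + j := by
        have := tri_sub 0 j
        simpa [tri_zero] using this
      have hp := qPochInf_split hq1 j
      have h1 : -(-1 * q ^ (1 - -(j : ℤ))) = q * q ^ j := by
        rw [sub_neg_eq_add, zpow_add₀ hq]; simp
      have hP := P_ne hq1 j
      rw [h0, h1, hp, zpow_add₀ hq, zpow_neg, zpow_natCast, zpow_natCast, div_pow]
      field_simp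
    · intro n hn
      by_contra hne
      apply hn
      have hpos : 1 ≤ n := by
        by_contra hlt
        exact hne ⟨(-n).toNat, by simp only; omega⟩
      have : qPochInf q (-(-1 * q ^ (1 - n))) = 0 := by
        unfold qPochInf
        apply tprod_of_exists_eq_zero
        refine ⟨(n - 1).toNat, ?_⟩
        rw [← zpow_natCast, Int.toNat_of_nonneg (by omega), neg_one_mul, neg_neg,
          ← zpow_add₀ hq]
        simp
      simp only [this, mul_zero]
  intro h0
  rw [h0, zero_mul, hL] at hm
  refine mul_ne_zero (qPochInf_ne hq1 _ (one_sub_ne hq1)) (qPochInf_ne hq1 _ fun k hk => ?_) hm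
  apply h (k + 1)
  rw [zpow_add₀ hq, zpow_natCast, zpow_one]
  field_simp at hk
  linear_combination hk

lemma theta_ne {q w : ℂ} (hq : q ≠ 0) (hq1 : ‖q‖ < 1) (hw : w ≠ 0)
    (h : ∀ m : ℤ, w ≠ -(q ^ m)) : thetaQ q w ≠ 0 := by
  obtain ⟨N, hN⟩ : ∃ N : ℕ, ‖w * q ^ N‖ < 1 := by
    have ht : Tendsto (fun n : ℕ => ‖w * q ^ n‖) atTop (𝓝 0) := by
      simpa using ((pow_tendsto hq1).const_mul w).norm
    exact (ht.eventually_lt_const one_pos).exists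
  have hne := theta_ne_small hq hq1 (mul_ne_zero hw (pow_ne_zero N hq)) hN (fun m hm => by
    apply h (m - N)
    rw [zpow_sub₀ hq, zpow_natCast]
    have := pow_ne_zero N hq
    field_simp
    exact hm)
  intro h0
  apply hne
  have := theta_shift hq hw (N : ℤ)
  rw [h0, mul_zero, zpow_natCast] at this
  exact this

end Stmt8Aux

open Stmt8Aux in
theorem stmt_8 (q a lam x : ℂ)
    (hq0 : 0 < ‖q‖) (hq1 : ‖q‖ < 1)
    (ha : a ≠ 0) (haq : ∀ m : ℤ, a ≠ q ^ m)
    (hlam : lam ≠ 0) (hlq : ∀ m : ℤ, lam ≠ -(q ^ m))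
    (halq : ∀ m : ℤ, a * lam ≠ -(q ^ m))
    (haxq : ∀ m : ℤ, a * x ≠ -(q ^ m))
    (hx : x ≠ 0) (hax : 1 < ‖a * x‖)
    (hxl : ∀ m : ℤ, x ≠ -(lam * q ^ m))
    (hxq : ∀ m : ℤ, x ≠ -(q ^ m))
    (ψB : ℂ → ℂ)
    (hψB : ∀ ξ : ℂ, ψB ξ =
      (qPochInf q q / qPochInf q (q / a)) * (thetaQ q (a * ξ) / thetaQ q ξ) *
        qPochInf q (-(q / ξ))) :
    (∑' n : ℤ, ψB (lam * q ^ n) / thetaQ q (lam * q ^ n / x))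
      =
      ((qPochInf q q / qPochInf q (q / a)) * (thetaQ q (a * lam) / thetaQ q lam) *
          (thetaQ q (a * q * x / lam) / thetaQ q (q * x / lam)) *
          (thetaQ q x / thetaQ q (a * x))) *
        ((thetaQ q (a * x) / thetaQ q x) * ∑' m : ℕ, (1 / (a * x)) ^ m / qPochInt q q m) := by
  have hq : q ≠ 0 := norm_pos_iff.1 hq0
  have hθx := theta_ne hq hq1 hx hxq
  have hθax := theta_ne hq hq1 (mul_ne_zero ha hx) haxq
  have hw : lam / (a * x) ≠ 0 := div_ne_zero hlam (mul_ne_zero ha hx)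
  have hwc : lam / (a * x) * lam⁻¹ = 1 / (a * x) := by field_simp
  have hm := main hq hq1 hw (inv_ne_zero hlam) (by
    rw [hwc, norm_div, norm_one]
    exact (div_lt_one (by linarith)).2 hax)
  rw [hwc] at hm
  have e1 : thetaQ q (a * q * x / lam) = thetaQ q (lam / (a * x)) := by
    rw [← theta_inv hq hw]
    congr 1
    field_simp
  have e2 : thetaQ q (q * x / lam) = thetaQ q (lam / x) := by
    rw [← theta_inv hq (div_ne_zero hlam hx)]
    congr 1
    field_simp
  have hterm : ∀ n : ℤ, ψB (lam * q ^ n) / thetaQ q (lam * q ^ n / x) =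
      (qPochInf q q / qPochInf q (q / a)) * (thetaQ q (a * lam) / thetaQ q lam) /
        thetaQ q (lam / x) *
      (q ^ tri n * (lam / (a * x)) ^ n * qPochInf q (-(lam⁻¹ * q ^ (1 - n)))) := by
    intro n
    have h1 : a * (lam * q ^ n) = a * lam * q ^ n := by ring
    have h2 : lam * q ^ n / x = lam / x * q ^ n := by ring
    have h3 : q / (lam * q ^ n) = lam⁻¹ * q ^ (1 - n) := by
      rw [zpow_sub₀ hq, zpow_one]
      field_simp
    rw [hψB, h1, h2, h3, theta_shift hq (mul_ne_zero ha hlam), theta_shift hq hlam,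
      theta_shift hq (div_ne_zero hlam hx), mul_zpow, div_zpow, div_zpow, mul_zpow]
    have k1 := zpow_ne_zero (tri n) hq
    have k2 := zpow_ne_zero n hlam
    have k3 := zpow_ne_zero n ha
    have k4 := zpow_ne_zero n hx
    generalize thetaQ q lam = A
    generalize thetaQ q (lam / x) = B
    generalize qPochInf q (q / a) = C
    simp only [div_eq_mul_inv, mul_inv, inv_inv]
    field_simp
  simp only [qPochInt_eq]
  rw [tsum_congr hterm, tsum_mul_left, hm, e1, e2]
  generalize thetaQ q lam = A
  generalize thetaQ q (lam / x) = B
  generalize qPochInf q (q / a) = C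
  simp only [div_eq_mul_inv]
  generalize (∑' k : ℕ, (1 * (a * x)⁻¹) ^ k * (P q k)⁻¹) = S
  linear_combination (- qPochInf q q * C⁻¹ * (thetaQ q (a * lam) * A⁻¹) *
    thetaQ q (lam * (a * x)⁻¹) * B⁻¹ * S) *
    (mul_inv_cancel₀ hθx * (thetaQ q (a * x) * (thetaQ q (a * x))⁻¹) + mul_inv_cancel₀ hθax)
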